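/- Let ω ∈ ℝ³ with 0 < ‖ω‖ < 2π, write θ = ‖ω‖ and K = ω̂. Then the series ∑_{j=0}^∞ (B_j / j!) K^j (with B_j the Bernoulli numbers in the convention B₁ = −1/2) converges and equals I − (1/2) K + (((1/2)θ sin θ + cos θ − 1)/(θ²(cos θ − 1))) K², where I is the 3×3 identity matrix. -/

import Mathlib

open Real

/-- The hat map `∧ : ℝ³ → 𝔰𝔬(3)`. -/
noncomputable def hatSO3 (ω : EuclideanSpace ℝ (Fin 3)) : Matrix (Fin 3) (Fin 3) ℝ :=
  !![0, -ω 2, ω 1; ω 2, 0, -ω 0; -ω 1, ω 0, 0]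

/-- The Bernoulli numbers satisfy `|Bₙ / n!| (2π)ⁿ ≤ 4`. -/
lemma abs_bernoulli_div_factorial_mul_le (n : ℕ) :
    |(bernoulli n : ℝ) / n.factorial| * (2 * π) ^ n ≤ 4 := by
  rcases Nat.even_or_odd' n with ⟨k, rfl | rfl⟩
  · rcases Nat.eq_zero_or_pos k with rfl | hk
    · norm_num
    have hz := hasSum_zeta_nat hk.ne'
    have hle : (-1 : ℝ) ^ (k + 1) * (2 : ℝ) ^ (2 * k - 1) * π ^ (2 * k) *
        bernoulli (2 * k) / (2 * k).factorial ≤ π ^ 2 / 6 := by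
      refine hasSum_le (fun m => ?_) hz hasSum_zeta_two
      rcases Nat.eq_zero_or_pos m with rfl | hm
      · simp [hk.ne']
      · have : (1 : ℝ) ≤ m := by exact_mod_cast hm
        gcongr
        omega
    have hnonneg := hz.nonneg fun m => by positivity
    have hpow : (2 : ℝ) ^ (2 * k) = 2 * 2 ^ (2 * k - 1) := by
      rw [← pow_succ']
      congr 1
      omega
    have heq : |(bernoulli (2 * k) : ℝ) / (2 * k).factorial| * (2 * π) ^ (2 * k) =
        2 * ((-1 : ℝ) ^ (k + 1) * (2 : ℝ) ^ (2 * k - 1) * π ^ (2 * k) *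
          bernoulli (2 * k) / (2 * k).factorial) := by
      rw [← abs_of_nonneg hnonneg, mul_pow, hpow]
      simp only [abs_mul, abs_div, abs_pow, abs_neg, abs_one, one_pow, Nat.abs_cast,
        abs_of_pos pi_pos, Nat.abs_ofNat]
      ring
    rw [heq]
    nlinarith [pi_pos, pi_lt_d2]
  · rcases Nat.eq_zero_or_pos k with rfl | hk
    · norm_num [abs_div]
      linarith [pi_lt_d2]
    · rw [bernoulli_eq_zero_of_odd ⟨k, rfl⟩ (by omega)]
      norm_num

lemma summable_norm_bernoulli_div_factorial_mul_pow {z : ℂ} (hz : ‖z‖ < 2 * π) :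
    Summable fun n : ℕ => ‖(bernoulli n : ℂ) / n.factorial * z ^ n‖ := by
  have hpi : 0 < 2 * π := two_pi_pos
  have hgeom : Summable fun n : ℕ => 4 * (‖z‖ / (2 * π)) ^ n :=
    (summable_geometric_of_lt_one (by positivity) ((div_lt_one hpi).2 hz)).mul_left 4
  refine hgeom.of_nonneg_of_le (fun n => norm_nonneg _) fun n => ?_
  have hb := abs_bernoulli_div_factorial_mul_le n
  have hnorm : ‖(bernoulli n : ℂ) / n.factorial‖ = |(bernoulli n : ℝ) / n.factorial| := by
    rw [← Real.norm_eq_abs, ← Complex.norm_real]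
    push_cast
    rfl
  rw [norm_mul, norm_pow, hnorm, div_pow, mul_div_assoc', le_div_iff₀ (by positivity),
    mul_right_comm]
  gcongr

/-- The exponential generating function of the Bernoulli numbers inside its disc of convergence. -/
lemma tsum_bernoulli_mul_exp_sub_one {z : ℂ} (hz : ‖z‖ < 2 * π) :
    (∑' n : ℕ, (bernoulli n : ℂ) / n.factorial * z ^ n) * (Complex.exp z - 1) = z := by
  have hb := summable_norm_bernoulli_div_factorial_mul_pow hz
  have he := NormedSpace.norm_expSeries_div_summable z
  have hcoeff (n : ℕ) : ∑ p ∈ Finset.HasAntidiagonal.antidiagonal n,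
      (bernoulli p.1 : ℂ) / p.1.factorial * z ^ p.1 * (z ^ p.2 / p.2.factorial) =
      (if n = 1 then z else 0) + (bernoulli n : ℂ) / n.factorial * z ^ n := by
    have hmul : bernoulliPowerSeries ℂ * PowerSeries.exp ℂ =
        PowerSeries.X + bernoulliPowerSeries ℂ := by
      linear_combination bernoulliPowerSeries_mul_exp_sub_one ℂ
    have h := congrArg (fun f => PowerSeries.coeff n f * z ^ n) hmul
    simp only [PowerSeries.coeff_mul, map_add, PowerSeries.coeff_X, bernoulliPowerSeries,
      PowerSeries.coeff_mk, PowerSeries.coeff_exp, Finset.sum_mul, add_mul] at h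
    convert h using 1
    · refine Finset.sum_congr rfl fun p hp => ?_
      rw [← Finset.HasAntidiagonal.mem_antidiagonal.1 hp, pow_add]
      simp
      ring
    · congr 1
      · split_ifs with h1 <;> simp [h1]
      · simp
  have hprod := tsum_mul_tsum_eq_tsum_sum_antidiagonal_of_summable_norm hb he
  simp only [hcoeff] at hprod
  rw [(hasSum_ite_eq 1 z).summable.tsum_add hb.of_norm, tsum_ite_eq,
    ← congrFun NormedSpace.exp_eq_tsum_div z, ← Complex.exp_eq_exp_ℂ] at hprod
  linear_combination hprod

/-- The real part of the Bernoulli generating function at `iθ` is `(θ / 2) cot (θ / 2)`. -/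
lemma hasSum_re_bernoulli_div_factorial_mul_I_pow {θ : ℝ} (hpos : 0 < θ) (hlt : θ < 2 * π) :
    HasSum (fun n : ℕ => ((bernoulli n : ℂ) / n.factorial * (θ * Complex.I) ^ n).re)
      (θ * sin θ / (2 * (1 - cos θ))) := by
  have hz : ‖(θ * Complex.I : ℂ)‖ < 2 * π := by simpa [abs_of_pos hpos] using hlt
  have hS := tsum_bernoulli_mul_exp_sub_one hz
  have hsum := Complex.hasSum_re (summable_norm_bernoulli_div_factorial_mul_pow hz).of_norm.hasSum
  convert hsum using 1
  generalize (∑' n : ℕ, (bernoulli n : ℂ) / n.factorial * (θ * Complex.I) ^ n) = S at hS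
  have hcos : 1 - cos θ ≠ 0 := fun h =>
    hpos.ne' ((cos_eq_one_iff_of_lt_of_lt (by linarith) hlt).1 (by linarith))
  have hre := congrArg Complex.re hS
  have him := congrArg Complex.im hS
  simp [Complex.exp_ofReal_mul_I_re, Complex.exp_ofReal_mul_I_im] at hre him
  field_simp
  linear_combination (1 - cos θ) * hre - sin θ * him + S.re * sin_sq_add_cos_sq θ

lemma hatSO3_pow_three (ω : EuclideanSpace ℝ (Fin 3)) :
    hatSO3 ω ^ 3 = -(‖ω‖ ^ 2) • hatSO3 ω := by
  rw [EuclideanSpace.norm_sq_eq, Fin.sum_univ_three]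
  simp only [Real.norm_eq_abs, sq_abs]
  ext i j
  fin_cases i <;> fin_cases j <;>
    simp [hatSO3, pow_succ, Matrix.mul_apply, Fin.sum_univ_three] <;> ring

lemma hatSO3_pow_two_mul_add_two (ω : EuclideanSpace ℝ (Fin 3)) (k : ℕ) :
    hatSO3 ω ^ (2 * k + 2) = (-(‖ω‖ ^ 2)) ^ k • hatSO3 ω ^ 2 := by
  induction k with
  | zero => simp
  | succ k ih =>
    rw [show 2 * (k + 1) + 2 = (2 * k + 2) + 2 by ring, pow_add, ih, smul_mul_assoc, ← pow_add,
      show 2 + 2 = 3 + 1 from rfl, pow_succ _ 3, hatSO3_pow_three, smul_mul_assoc, smul_smul,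
      ← pow_succ, ← sq]

/-- Each term of the series, in terms of the powers `1`, `K` and `K ^ 2` of `K = hatSO3 ω`. -/
lemma bernoulli_smul_hatSO3_pow {ω : EuclideanSpace ℝ (Fin 3)} (hω : ‖ω‖ ≠ 0) (n : ℕ) :
    ((bernoulli n : ℝ) / n.factorial) • hatSO3 ω ^ n =
      (if n = 0 then (1 : Matrix (Fin 3) (Fin 3) ℝ) else 0) -
        (if n = 1 then (1 / 2 : ℝ) • hatSO3 ω else 0) +
      (((if n = 0 then 1 else 0) -
        ((bernoulli n : ℂ) / n.factorial * (‖ω‖ * Complex.I) ^ n).re) / ‖ω‖ ^ 2) •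
          hatSO3 ω ^ 2 := by
  rcases Nat.even_or_odd' n with ⟨k, rfl | rfl⟩
  · cases k with
    | zero => simp
    | succ k =>
      have hcast : ((bernoulli (2 * (k + 1)) : ℂ) / (2 * (k + 1)).factorial *
          (‖ω‖ * Complex.I) ^ (2 * (k + 1))) = ((bernoulli (2 * (k + 1)) /
            (2 * (k + 1)).factorial * (-(‖ω‖ ^ 2)) ^ (k + 1) : ℝ) : ℂ) := by
        rw [pow_mul, mul_pow, Complex.I_sq]
        push_cast
        ring
      rw [hcast, Complex.ofReal_re, show 2 * (k + 1) = 2 * k + 2 by ring,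
        hatSO3_pow_two_mul_add_two, smul_smul]
      simp only [Nat.add_eq_zero_iff, OfNat.ofNat_ne_zero, and_false, if_false,
        show 2 * k + 2 ≠ 1 by omega, sub_zero, zero_add, zero_sub]
      congr 1
      field_simp
      ring
  · rcases Nat.eq_zero_or_pos k with rfl | hk
    · simp [neg_div]
    · rw [bernoulli_eq_zero_of_odd ⟨k, rfl⟩ (by omega)]
      simp [hk.ne']

/-- For `0 < ‖ω‖ < 2π`, the series `∑_{j≥0} (B_j/j!) K^j` (Bernoulli numbers with
`B₁ = −1/2`) converges to the exact closed form of `dexp⁻¹` on `SO(3)`. -/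
theorem dexp_inv_so3_series (ω : EuclideanSpace ℝ (Fin 3))
    (hω : 0 < ‖ω‖) (hω2 : ‖ω‖ < 2 * π) :
    HasSum (fun j : ℕ => ((bernoulli j : ℝ) / (j.factorial : ℝ)) • hatSO3 ω ^ j)
      (1 - (1 / 2 : ℝ) • hatSO3 ω
        + (((1 / 2) * ‖ω‖ * sin ‖ω‖ + cos ‖ω‖ - 1) / (‖ω‖ ^ 2 * (cos ‖ω‖ - 1))) •
            hatSO3 ω ^ 2) := by
  have hcos : cos ‖ω‖ - 1 ≠ 0 := fun h =>
    hω.ne' ((cos_eq_one_iff_of_lt_of_lt (by linarith) hω2).1 (by linarith))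
  have hcos' : 1 - cos ‖ω‖ ≠ 0 := fun h => hcos (by linarith)
  have hsum := ((hasSum_ite_eq 0 (1 : Matrix (Fin 3) (Fin 3) ℝ)).sub
    (hasSum_ite_eq 1 ((1 / 2 : ℝ) • hatSO3 ω))).add
    ((((hasSum_ite_eq 0 (1 : ℝ)).sub
      (hasSum_re_bernoulli_div_factorial_mul_I_pow hω hω2)).div_const (‖ω‖ ^ 2)).smul_const
        (hatSO3 ω ^ 2))
  have hcoeff : ((1 / 2) * ‖ω‖ * sin ‖ω‖ + cos ‖ω‖ - 1) / (‖ω‖ ^ 2 * (cos ‖ω‖ - 1)) =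
      (1 - ‖ω‖ * sin ‖ω‖ / (2 * (1 - cos ‖ω‖))) / ‖ω‖ ^ 2 := by
    field_simp
    ring
  rw [hcoeff, funext (bernoulli_smul_hatSO3_pow hω.ne')]
  exact hsum
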